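/- Let X_1,…,X_K be mutually independent finitely-valued random variables and let (X_1,…,X_K,Y,Z) be jointly distributed. Let R^s(X_𝒦) = max_{𝒦′⊆𝒦} [ I(X_{𝒦′};Y|X_{𝒦∖𝒦′}) − I(X_{𝒦′};Z|X_{𝒦∖𝒦′}) ]⁺, let 𝒦′* ⊆ 𝒦 attain this maximum, and assume R^s(X_𝒦) > 0. Then the maximum of ∑_{k∈𝒦} R_k^o over all rate tuples in 𝓡(X_𝒦,𝒦′*) satisfying ∑_{k∈𝒦} R_k^s = R^s(X_𝒦) is attained and equals I(X_{𝒦∖𝒦′*};Y) + I(X_{𝒦′*};Z|X_{𝒦∖𝒦′*}). -/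

import Mathlib

open scoped Classical

noncomputable section

/-- Probability that random variable `X` takes value `x`, under pmf `p` on a finite sample space. -/
def probOf {Ω α : Type} [Fintype Ω] (p : Ω → ℝ) (X : Ω → α) (x : α) : ℝ :=
  ∑ ω, if X ω = x then p ω else 0

/-- Shannon entropy of a finitely-valued random variable. -/
def Hent {Ω α : Type} [Fintype Ω] [Fintype α] (p : Ω → ℝ) (X : Ω → α) : ℝ :=
  -∑ x, probOf p X x * Real.log (probOf p X x)

/-- Conditional entropy `H(X | C)`. -/
def condHent {Ω α γ : Type} [Fintype Ω] [Fintype α] [Fintype γ]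
    (p : Ω → ℝ) (X : Ω → α) (C : Ω → γ) : ℝ :=
  Hent p (fun ω => (X ω, C ω)) - Hent p C

/-- Conditional mutual information `I(A;B | C)`. -/
def IcondMut {Ω α β γ : Type} [Fintype Ω] [Fintype α] [Fintype β] [Fintype γ]
    (p : Ω → ℝ) (A : Ω → α) (B : Ω → β) (C : Ω → γ) : ℝ :=
  condHent p A C + condHent p B C - condHent p (fun ω => (A ω, B ω)) C

/-- Mutual information `I(A;B)`. -/
def Imut {Ω α β : Type} [Fintype Ω] [Fintype α] [Fintype β]
    (p : Ω → ℝ) (A : Ω → α) (B : Ω → β) : ℝ :=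
  Hent p A + Hent p B - Hent p (fun ω => (A ω, B ω))

/-- `p` is a probability mass function. -/
def IsPMF {Ω : Type} [Fintype Ω] (p : Ω → ℝ) : Prop :=
  (∀ ω, 0 ≤ p ω) ∧ ∑ ω, p ω = 1

/-- The tuple `X_S = (X_k)_{k ∈ S}` as a random variable. -/
def tup {Ω ι : Type} {𝒳 : ι → Type} (X : ∀ k, Ω → 𝒳 k) (S : Finset ι) :
    Ω → ∀ k : S, 𝒳 k.1 :=
  fun ω k => X k.1 ω

/-- The random variables `X_1, …, X_K` are mutually independent. -/
def MutIndep {Ω ι : Type} [Fintype Ω] [Fintype ι] {𝒳 : ι → Type} [∀ k, Fintype (𝒳 k)]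
    (p : Ω → ℝ) (X : ∀ k, Ω → 𝒳 k) : Prop :=
  ∀ x : ∀ k, 𝒳 k, probOf p (fun ω k => X k ω) x = ∏ k, probOf p (X k) (x k)

/-- The rate region `𝓡(X_𝒦, 𝒦′)`. -/
def InRegion {Ω : Type} [Fintype Ω] {K : ℕ} {𝒳 : Fin K → Type} [∀ k, Fintype (𝒳 k)]
    {𝒴 𝒵 : Type} [Fintype 𝒴] [Fintype 𝒵]
    (p : Ω → ℝ) (X : ∀ k, Ω → 𝒳 k) (Y : Ω → 𝒴) (Z : Ω → 𝒵)
    (K' : Finset (Fin K)) (Rs Ro : Fin K → ℝ) : Prop :=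
  (∀ k, 0 ≤ Rs k) ∧ (∀ k, 0 ≤ Ro k) ∧ (∀ k ∈ Finset.univ \ K', Rs k = 0) ∧
    ∀ S ⊆ K', ∀ S' ⊆ S, ∀ T ⊆ Finset.univ \ K',
      ∑ k ∈ S, Rs k + ∑ k ∈ S \ S', Ro k + ∑ k ∈ T, Ro k ≤
        max 0 (IcondMut p (tup X (S ∪ T)) Y (tup X (Finset.univ \ (S ∪ T))) -
               IcondMut p (tup X S') Z (tup X (Finset.univ \ K')))

section Entropy

variable {Ω : Type} [Fintype Ω] {p : Ω → ℝ}

theorem sum_probOf_mul {α : Type} [Fintype α] (p : Ω → ℝ) (X : Ω → α) (φ : α → ℝ) :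
    ∑ x, probOf p X x * φ x = ∑ ω, p ω * φ (X ω) := by
  simp only [probOf, Finset.sum_mul, ite_mul, zero_mul]
  rw [Finset.sum_comm]
  simp

theorem Hent_eq_neg_sum {α : Type} [Fintype α] (p : Ω → ℝ) (X : Ω → α) :
    Hent p X = -∑ ω, p ω * Real.log (probOf p X (X ω)) := by
  rw [Hent, sum_probOf_mul p X fun x => Real.log (probOf p X x)]

/-- Entropy only depends on the partition of the sample space induced by the random variable. -/
theorem Hent_congr {α β : Type} [Fintype α] [Fintype β] (p : Ω → ℝ) (X : Ω → α) (Y : Ω → β)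
    (h : ∀ ω ω', X ω = X ω' ↔ Y ω = Y ω') : Hent p X = Hent p Y := by
  simp only [Hent_eq_neg_sum, probOf, h]

theorem probOf_nonneg {α : Type} (hp : IsPMF p) (X : Ω → α) (x : α) : 0 ≤ probOf p X x :=
  Finset.sum_nonneg fun ω _ => by split_ifs <;> simp [hp.1 ω]

theorem le_probOf {α : Type} (hp : IsPMF p) (X : Ω → α) (ω : Ω) : p ω ≤ probOf p X (X ω) := by
  have h := Finset.single_le_sum (f := fun ω' => if X ω' = X ω then p ω' else 0)
    (fun ω' _ => by split_ifs <;> simp [hp.1 ω']) (Finset.mem_univ ω)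
  simpa [probOf] using h

theorem sum_probOf {α : Type} [Fintype α] (hp : IsPMF p) (X : Ω → α) :
    ∑ x, probOf p X x = 1 := by
  simpa [hp.2] using sum_probOf_mul p X fun _ => 1

theorem sum_probOf_prod_left {α γ : Type} [Fintype α] (p : Ω → ℝ) (A : Ω → α) (C : Ω → γ)
    (c : γ) : ∑ a, probOf p (fun ω => (A ω, C ω)) (a, c) = probOf p C c := by
  simp only [probOf, Prod.mk.injEq]
  rw [Finset.sum_comm]
  refine Finset.sum_congr rfl fun ω _ => ?_
  by_cases h : C ω = c <;> simp [h]

theorem sum_probOf_mul_div_le_one {α β γ : Type} [Fintype α] [Fintype β] [Fintype γ]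
    (hp : IsPMF p) (A : Ω → α) (B : Ω → β) (C : Ω → γ) :
    ∑ ω, p ω * (probOf p (fun ω => (A ω, C ω)) (A ω, C ω) *
      probOf p (fun ω => (B ω, C ω)) (B ω, C ω) /
      (probOf p (fun ω => ((A ω, B ω), C ω)) ((A ω, B ω), C ω) * probOf p C (C ω))) ≤ 1 := by
  rw [← sum_probOf_mul p (fun ω => ((A ω, B ω), C ω)) fun x =>
    probOf p (fun ω => (A ω, C ω)) (x.1.1, x.2) * probOf p (fun ω => (B ω, C ω)) (x.1.2, x.2) /
      (probOf p (fun ω => ((A ω, B ω), C ω)) x * probOf p C x.2)]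
  calc
    _ ≤ ∑ x : (α × β) × γ, probOf p (fun ω => (A ω, C ω)) (x.1.1, x.2) *
          probOf p (fun ω => (B ω, C ω)) (x.1.2, x.2) / probOf p C x.2 := by
      refine Finset.sum_le_sum fun x _ => ?_
      have h₁ := probOf_nonneg hp (fun ω => (A ω, C ω)) (x.1.1, x.2)
      have h₂ := probOf_nonneg hp (fun ω => (B ω, C ω)) (x.1.2, x.2)
      have h₃ := probOf_nonneg hp C x.2
      rcases eq_or_ne (probOf p (fun ω => ((A ω, B ω), C ω)) x) 0 with h | h
      · rw [h, zero_mul]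
        positivity
      · rw [← mul_div_assoc, mul_div_mul_left _ _ h]
    _ = ∑ c, probOf p C c := by
      rw [Fintype.sum_prod_type_right]
      refine Finset.sum_congr rfl fun c _ => ?_
      simp only [Fintype.sum_prod_type, ← Finset.sum_div, ← Finset.mul_sum, ← Finset.sum_mul,
        sum_probOf_prod_left]
      exact mul_self_div_self _
    _ = 1 := sum_probOf hp C

theorem IcondMut_nonneg {α β γ : Type} [Fintype α] [Fintype β] [Fintype γ]
    (hp : IsPMF p) (A : Ω → α) (B : Ω → β) (C : Ω → γ) : 0 ≤ IcondMut p A B C := by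
  have hle : ∑ ω, (p ω * Real.log (probOf p (fun ω => (A ω, C ω)) (A ω, C ω)) +
      p ω * Real.log (probOf p (fun ω => (B ω, C ω)) (B ω, C ω)) -
      p ω * Real.log (probOf p (fun ω => ((A ω, B ω), C ω)) ((A ω, B ω), C ω)) -
      p ω * Real.log (probOf p C (C ω))) ≤
      ∑ ω, (p ω * (probOf p (fun ω => (A ω, C ω)) (A ω, C ω) *
      probOf p (fun ω => (B ω, C ω)) (B ω, C ω) /
      (probOf p (fun ω => ((A ω, B ω), C ω)) ((A ω, B ω), C ω) * probOf p C (C ω))) - p ω) := by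
    refine Finset.sum_le_sum fun ω _ => ?_
    rcases (hp.1 ω).eq_or_lt with h | h
    · simp [← h]
    have h₁ := h.trans_le (le_probOf hp (fun ω => (A ω, C ω)) ω)
    have h₂ := h.trans_le (le_probOf hp (fun ω => (B ω, C ω)) ω)
    have h₃ := h.trans_le (le_probOf hp (fun ω => ((A ω, B ω), C ω)) ω)
    have h₄ := h.trans_le (le_probOf hp C ω)
    have hlog := mul_le_mul_of_nonneg_left
      (Real.log_le_sub_one_of_pos (div_pos (mul_pos h₁ h₂) (mul_pos h₃ h₄))) h.le
    rw [Real.log_div (mul_pos h₁ h₂).ne' (mul_pos h₃ h₄).ne', Real.log_mul h₁.ne' h₂.ne',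
      Real.log_mul h₃.ne' h₄.ne'] at hlog
    linarith
  have hone := sum_probOf_mul_div_le_one hp A B C
  simp only [Finset.sum_sub_distrib, Finset.sum_add_distrib, hp.2] at hle
  simp only [IcondMut, condHent, Hent_eq_neg_sum]
  linarith

/-- Strong subadditivity of entropy. -/
theorem Hent_submodular {α β γ : Type} [Fintype α] [Fintype β] [Fintype γ]
    (hp : IsPMF p) (A : Ω → α) (B : Ω → β) (C : Ω → γ) :
    Hent p (fun ω => ((A ω, B ω), C ω)) + Hent p C ≤
      Hent p (fun ω => (A ω, C ω)) + Hent p (fun ω => (B ω, C ω)) := by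
  have h := IcondMut_nonneg hp A B C
  simp only [IcondMut, condHent] at h
  linarith

end Entropy

section Tuples

variable {Ω : Type} {ι : Type} {𝒳 : ι → Type}

theorem tup_eq_iff (X : ∀ k, Ω → 𝒳 k) (S : Finset ι) (ω ω' : Ω) :
    tup X S ω = tup X S ω' ↔ ∀ k ∈ S, X k ω = X k ω' := by
  simp [tup, funext_iff]

variable [Fintype Ω] {p : Ω → ℝ} [∀ k, Fintype (𝒳 k)] [DecidableEq ι]

theorem Hent_tup_empty (hp : IsPMF p) (X : ∀ k, Ω → 𝒳 k) : Hent p (tup X ∅) = 0 := by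
  have h : ∀ ω ω', (tup X ∅ ω = tup X ∅ ω') = True := fun ω ω' => by simp [tup_eq_iff]
  simp only [Hent_eq_neg_sum, probOf, h, if_true, hp.2, Real.log_one, mul_zero,
    Finset.sum_const_zero, neg_zero]

theorem Hent_pair_tup_submodular {𝒲 : Type} [Fintype 𝒲] (hp : IsPMF p) (X : ∀ k, Ω → 𝒳 k)
    (W : Ω → 𝒲) (S T : Finset ι) :
    Hent p (fun ω => (W ω, tup X (S ∪ T) ω)) + Hent p (fun ω => (W ω, tup X (S ∩ T) ω)) ≤
      Hent p (fun ω => (W ω, tup X S ω)) + Hent p (fun ω => (W ω, tup X T ω)) := by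
  have h := Hent_submodular hp (tup X S) (tup X T) (fun ω => (W ω, tup X (S ∩ T) ω))
  convert h using 2 <;> apply Hent_congr <;> intro ω ω' <;>
    simp only [Prod.mk.injEq, tup_eq_iff, Finset.mem_union, Finset.mem_inter] <;> grind

theorem condHent_tup_anti {𝒲 : Type} [Fintype 𝒲] (hp : IsPMF p) (X : ∀ k, Ω → 𝒳 k)
    (W : Ω → 𝒲) {S T : Finset ι} (hST : S ⊆ T) :
    condHent p W (tup X T) ≤ condHent p W (tup X S) := by
  have h := Hent_submodular hp W (tup X T) (tup X S)
  have h₁ : Hent p (fun ω => ((W ω, tup X T ω), tup X S ω)) =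
      Hent p (fun ω => (W ω, tup X T ω)) := by
    apply Hent_congr
    intro ω ω'
    simp only [Prod.mk.injEq, tup_eq_iff]
    grind
  have h₂ : Hent p (fun ω => (tup X T ω, tup X S ω)) = Hent p (tup X T) := by
    apply Hent_congr
    intro ω ω'
    simp only [Prod.mk.injEq, tup_eq_iff]
    grind
  rw [condHent, condHent]
  linarith

theorem Hent_tup_union_le (hp : IsPMF p) (X : ∀ k, Ω → 𝒳 k) (S T : Finset ι) :
    Hent p (tup X (S ∪ T)) ≤ Hent p (tup X S) + Hent p (tup X T) := by
  have h := Hent_submodular hp (tup X S) (tup X T) (tup X ∅)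
  rw [Hent_tup_empty hp, add_zero] at h
  convert h using 2 <;> apply Hent_congr <;> intro ω ω' <;>
    simp only [Prod.mk.injEq, tup_eq_iff, Finset.mem_union] <;> grind

theorem Hent_tup_le_sum (hp : IsPMF p) (X : ∀ k, Ω → 𝒳 k) (S : Finset ι) :
    Hent p (tup X S) ≤ ∑ k ∈ S, Hent p (X k) := by
  induction S using Finset.induction_on with
  | empty => simp [Hent_tup_empty hp]
  | insert k S hk ih =>
    have h := Hent_tup_union_le hp X {k} S
    have hsingle : Hent p (tup X {k}) = Hent p (X k) := by
      apply Hent_congr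
      intro ω ω'
      simp [tup_eq_iff]
    rw [Finset.sum_insert hk, Finset.insert_eq]
    linarith

theorem Hent_tup_univ [Fintype ι] (hp : IsPMF p) (X : ∀ k, Ω → 𝒳 k) (hind : MutIndep p X) :
    Hent p (tup X Finset.univ) = ∑ k, Hent p (X k) := by
  have h : Hent p (tup X Finset.univ) = Hent p (fun ω k => X k ω) := by
    apply Hent_congr
    intro ω ω'
    rw [tup_eq_iff]
    simp [funext_iff]
  rw [h]
  simp only [Hent_eq_neg_sum, hind _, Finset.sum_neg_distrib]
  rw [Finset.sum_comm]
  congr 1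
  refine Finset.sum_congr rfl fun ω _ => ?_
  rcases (hp.1 ω).eq_or_lt with h₀ | h₀
  · simp [← h₀]
  · rw [Real.log_prod fun k _ => (h₀.trans_le (le_probOf hp (X k) ω)).ne', Finset.mul_sum]

theorem Hent_tup_eq_sum [Fintype ι] (hp : IsPMF p) (X : ∀ k, Ω → 𝒳 k) (hind : MutIndep p X)
    (S : Finset ι) : Hent p (tup X S) = ∑ k ∈ S, Hent p (X k) := by
  refine le_antisymm (Hent_tup_le_sum hp X S) ?_
  have h₁ := Hent_tup_union_le hp X S Sᶜ
  rw [Finset.union_compl, Hent_tup_univ hp X hind] at h₁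
  linarith [Hent_tup_le_sum hp X Sᶜ, Finset.sum_add_sum_compl S fun k => Hent p (X k)]

theorem Hent_tup_modular [Fintype ι] (hp : IsPMF p) (X : ∀ k, Ω → 𝒳 k) (hind : MutIndep p X)
    (S T : Finset ι) :
    Hent p (tup X (S ∪ T)) + Hent p (tup X (S ∩ T)) = Hent p (tup X S) + Hent p (tup X T) := by
  simp only [Hent_tup_eq_sum hp X hind]
  exact Finset.sum_union_inter

theorem IcondMut_tup_eq {𝒲 : Type} [Fintype 𝒲] (p : Ω → ℝ) (X : ∀ k, Ω → 𝒳 k) (W : Ω → 𝒲)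
    (S T : Finset ι) :
    IcondMut p (tup X S) W (tup X T) =
      condHent p W (tup X T) - condHent p W (tup X (S ∪ T)) := by
  have h₁ : Hent p (fun ω => (tup X S ω, tup X T ω)) = Hent p (tup X (S ∪ T)) := by
    apply Hent_congr
    intro ω ω'
    simp only [Prod.mk.injEq, tup_eq_iff, Finset.mem_union]
    grind
  have h₂ : Hent p (fun ω => ((tup X S ω, W ω), tup X T ω)) =
      Hent p (fun ω => (W ω, tup X (S ∪ T) ω)) := by
    apply Hent_congr
    intro ω ω'
    simp only [Prod.mk.injEq, tup_eq_iff, Finset.mem_union]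
    grind
  simp only [IcondMut, condHent, h₁, h₂]
  ring

theorem Imut_tup_eq {𝒲 : Type} [Fintype 𝒲] (hp : IsPMF p) (X : ∀ k, Ω → 𝒳 k) (W : Ω → 𝒲)
    (S : Finset ι) :
    Imut p (tup X S) W = condHent p W (tup X ∅) - condHent p W (tup X S) := by
  have h₁ : Hent p (fun ω => (tup X S ω, W ω)) = Hent p (fun ω => (W ω, tup X S ω)) := by
    apply Hent_congr
    intro ω ω'
    simp only [Prod.mk.injEq]
    tauto
  have h₂ : Hent p (fun ω => (W ω, tup X ∅ ω)) = Hent p W := by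
    apply Hent_congr
    intro ω ω'
    simp [tup_eq_iff]
  simp only [Imut, condHent, h₁, h₂, Hent_tup_empty hp]
  ring

/-- For independent inputs, `S ↦ H(W | X_S)` is submodular. -/
theorem condHent_tup_submodular [Fintype ι] {𝒲 : Type} [Fintype 𝒲] (hp : IsPMF p)
    (X : ∀ k, Ω → 𝒳 k) (hind : MutIndep p X) (W : Ω → 𝒲) (S T : Finset ι) :
    condHent p W (tup X (S ∪ T)) + condHent p W (tup X (S ∩ T)) ≤
      condHent p W (tup X S) + condHent p W (tup X T) := by
  simp only [condHent]
  linarith [Hent_pair_tup_submodular hp X W S T, Hent_tup_modular hp X hind S T]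

end Tuples

section Polymatroid

variable {ι : Type*} [DecidableEq ι]

/-- The greedy algorithm extends a base of a polymatroid restricted to `A` to a larger set. -/
theorem exists_extend_base {f : Finset ι → ℝ} (hmono : Monotone f)
    (hsub : ∀ S T, f (S ∪ T) + f (S ∩ T) ≤ f S + f T) (A : Finset ι) (w : ι → ℝ)
    (hw : ∀ k, 0 ≤ w k) (hle : ∀ U ⊆ A, ∑ k ∈ U, w k ≤ f U) (heq : ∑ k ∈ A, w k = f A)
    (D : Finset ι) :
    ∃ w' : ι → ℝ, (∀ k, 0 ≤ w' k) ∧ (∀ U ⊆ D ∪ A, ∑ k ∈ U, w' k ≤ f U) ∧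
      ∑ k ∈ D ∪ A, w' k = f (D ∪ A) ∧ ∀ k ∈ A, w' k = w k := by
  induction D using Finset.induction_on with
  | empty => exact ⟨w, hw, by simpa using hle, by simpa using heq, fun _ _ => rfl⟩
  | insert x D _ ih =>
    obtain ⟨v, hv, hvle, hveq, hvA⟩ := ih
    rw [Finset.insert_union]
    by_cases hx : x ∈ D ∪ A
    · rw [Finset.insert_eq_of_mem hx]
      exact ⟨v, hv, hvle, hveq, hvA⟩
    generalize hV : D ∪ A = V at *
    have hsum : ∀ U, x ∉ U →
        ∑ k ∈ U, Function.update v x (f (insert x V) - f V) k = ∑ k ∈ U, v k := fun U hU =>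
      Finset.sum_congr rfl fun k hk => Function.update_of_ne (by grind) _ _
    refine ⟨Function.update v x (f (insert x V) - f V), fun k => ?_, fun U hU => ?_, ?_,
      fun k hk => ?_⟩
    · rcases eq_or_ne k x with rfl | hk
      · simpa using hmono (Finset.subset_insert k V)
      · simpa [hk] using hv k
    · by_cases hxU : x ∈ U
      · have hUV : U.erase x ⊆ V := by grind
        rw [← Finset.add_sum_erase _ _ hxU, hsum _ (Finset.notMem_erase x U),
          Function.update_self]
        have h := hsub U V
        rw [show U ∪ V = insert x V by grind, show U ∩ V = U.erase x by grind] at h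
        linarith [hvle _ hUV]
      · rw [hsum _ hxU]
        exact hvle U (by grind)
    · rw [Finset.sum_insert hx, hsum _ hx, hveq, Function.update_self]
      ring
    · rw [Function.update_of_ne (by grind), hvA k hk]

/-- A polymatroid has a base that is tight on a prescribed set. -/
theorem exists_base_tight [Fintype ι] {f : Finset ι → ℝ} (hempty : f ∅ = 0) (hmono : Monotone f)
    (hsub : ∀ S T, f (S ∪ T) + f (S ∩ T) ≤ f S + f T) (A : Finset ι) :
    ∃ w : ι → ℝ, (∀ k, 0 ≤ w k) ∧ (∀ U, ∑ k ∈ U, w k ≤ f U) ∧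
      ∑ k ∈ A, w k = f A ∧ ∑ k, w k = f Finset.univ := by
  obtain ⟨w, hw, hle, heq, -⟩ := exists_extend_base hmono hsub ∅ 0 (by simp)
    (fun U hU => by simp [Finset.subset_empty.1 hU, hempty]) (by simp [hempty]) A
  rw [Finset.union_empty] at hle heq
  obtain ⟨w', hw', hle', heq', hA⟩ := exists_extend_base hmono hsub A w hw hle heq Finset.univ
  rw [Finset.union_eq_left.2 (Finset.subset_univ A)] at hle' heq'
  exact ⟨w', hw', fun U => hle' U (Finset.subset_univ U),
    (Finset.sum_congr rfl hA).trans heq, heq'⟩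

/-- Every vector dominating a supermodular function can be lowered to a base. -/
theorem exists_le_base_of_supermodular [Fintype ι] {g : Finset ι → ℝ} (hempty : g ∅ = 0)
    (hsup : ∀ S T, g S + g T ≤ g (S ∪ T) + g (S ∩ T)) (w : ι → ℝ)
    (hw : ∀ U, g U ≤ ∑ k ∈ U, w k) :
    ∃ v : ι → ℝ, (∀ k, v k ≤ w k) ∧ (∀ U, g U ≤ ∑ k ∈ U, v k) ∧
      ∑ k, v k = g Finset.univ := by
  suffices h : ∀ D : Finset ι, ∃ v : ι → ℝ, (∀ k, v k ≤ w k) ∧ (∀ U, g U ≤ ∑ k ∈ U, v k) ∧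
      ∃ C, D ⊆ C ∧ ∑ k ∈ C, v k = g C by
    obtain ⟨v, hvw, hgv, C, hC, heq⟩ := h Finset.univ
    rw [Finset.univ_subset_iff.1 hC] at heq
    exact ⟨v, hvw, hgv, heq⟩
  intro D
  induction D using Finset.induction_on with
  | empty => exact ⟨w, fun _ => le_rfl, hw, ∅, le_rfl, by simp [hempty]⟩
  | insert x D _ ih =>
    obtain ⟨v, hvw, hgv, C, hDC, heq⟩ := ih
    by_cases hxC : x ∈ C
    · exact ⟨v, hvw, hgv, C, Finset.insert_subset hxC hDC, heq⟩
    obtain ⟨U, hU, hmin⟩ := Finset.exists_min_image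
      (Finset.univ.filter fun U : Finset ι => x ∈ U) (fun U => ∑ k ∈ U, v k - g U)
      ⟨{x}, by simp⟩
    simp only [Finset.mem_filter, Finset.mem_univ, true_and] at hU hmin
    set δ := ∑ k ∈ U, v k - g U with hδ
    have hδ₀ : 0 ≤ δ := sub_nonneg.2 (hgv U)
    set v' : ι → ℝ := fun k => v k - if k = x then δ else 0 with hv'
    have hsum : ∀ V, ∑ k ∈ V, v' k = ∑ k ∈ V, v k - if x ∈ V then δ else 0 := fun V => by
      simp [hv', Finset.sum_sub_distrib]
    have hgv' : ∀ V, g V ≤ ∑ k ∈ V, v' k := fun V => by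
      rw [hsum]
      split_ifs with hV
      · linarith [hmin V hV]
      · linarith [hgv V]
    have hUC : ∑ k ∈ U ∪ C, v' k ≤ g (U ∪ C) := by
      have h₁ : ∑ k ∈ U, v' k = g U := by rw [hsum, if_pos hU, hδ]; ring
      have h₂ : ∑ k ∈ C, v' k = g C := by rw [hsum, if_neg hxC, heq]; ring
      have h₃ := Finset.sum_union_inter (s₁ := U) (s₂ := C) (f := v')
      linarith [hsup U C, hgv' (U ∩ C)]
    refine ⟨v', fun k => ?_, hgv', U ∪ C, by grind, le_antisymm hUC (hgv' _)⟩
    have h := hvw k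
    simp only [hv']
    split_ifs <;> linarith

end Polymatroid

/-- Rates for the polymatroidal form of the region: `f` bounds the total rates, `g` is the
randomness needed to confuse the eavesdropper, and `A` is the set of users with secret messages. -/
theorem exists_rates {ι : Type*} [Fintype ι] [DecidableEq ι] {f g : Finset ι → ℝ}
    (hf : f ∅ = 0) (hfmono : Monotone f) (hfsub : ∀ S T, f (S ∪ T) + f (S ∩ T) ≤ f S + f T)
    (hg : g ∅ = 0) (hgmono : Monotone g) (hgsup : ∀ S T, g S + g T ≤ g (S ∪ T) + g (S ∩ T))
    (A : Finset ι) (hgA : ∀ S, g (S ∩ A) = g S)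
    (hA : ∀ S ⊆ A, f (A \ S) + g S ≤ f A) :
    ∃ Rs Ro : ι → ℝ, (∀ k, 0 ≤ Rs k) ∧ (∀ k, 0 ≤ Ro k) ∧ (∀ k ∈ Finset.univ \ A, Rs k = 0) ∧
      (∀ S ⊆ A, ∀ S' ⊆ S, ∀ T ⊆ Finset.univ \ A,
        ∑ k ∈ S, Rs k + ∑ k ∈ S \ S', Ro k + ∑ k ∈ T, Ro k ≤ f (S ∪ T) - g S') ∧
      ∑ k, Rs k = f A - g A ∧ ∑ k, Ro k = f Finset.univ - f A + g A := by
  obtain ⟨w, hw, hwf, hwA, hwuniv⟩ := exists_base_tight hf hfmono hfsub A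
  have hgw : ∀ U, g U ≤ ∑ k ∈ U, w k := fun U => by
    have h₁ := Finset.sum_sdiff (f := w) (Finset.inter_subset_right : U ∩ A ⊆ A)
    have h₂ : ∑ k ∈ U ∩ A, w k ≤ ∑ k ∈ U, w k :=
      Finset.sum_le_sum_of_subset_of_nonneg Finset.inter_subset_left fun k _ _ => hw k
    linarith [hA (U ∩ A) Finset.inter_subset_right, hwf (A \ (U ∩ A)), hgA U]
  obtain ⟨v, hvw, hgv, hvuniv⟩ := exists_le_base_of_supermodular hg hgsup w hgw
  have hv : ∀ k, 0 ≤ v k := fun k => by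
    have h := hgv {k}
    rw [Finset.sum_singleton] at h
    linarith [hgmono (Finset.empty_subset {k})]
  have hvA : ∑ k ∈ A, v k = g A := by
    refine le_antisymm ?_ (hgv A)
    rw [← Finset.univ_inter A, hgA, ← hvuniv, Finset.univ_inter]
    exact Finset.sum_le_sum_of_subset_of_nonneg (Finset.subset_univ A) fun k _ _ => hv k
  set Rs : ι → ℝ := fun k => if k ∈ A then w k - v k else 0 with hRs
  set Ro : ι → ℝ := fun k => if k ∈ A then v k else w k with hRo
  have hsRs : ∀ S ⊆ A, ∑ k ∈ S, Rs k = ∑ k ∈ S, w k - ∑ k ∈ S, v k := fun S hS => by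
    rw [← Finset.sum_sub_distrib]
    exact Finset.sum_congr rfl fun k hk => if_pos (hS hk)
  have hsRo : ∀ S ⊆ A, ∑ k ∈ S, Ro k = ∑ k ∈ S, v k := fun S hS =>
    Finset.sum_congr rfl fun k hk => if_pos (hS hk)
  have hsRo' : ∀ T ⊆ Finset.univ \ A, ∑ k ∈ T, Ro k = ∑ k ∈ T, w k := fun T hT =>
    Finset.sum_congr rfl fun k hk => if_neg (Finset.mem_sdiff.1 (hT hk)).2
  have hRs₀ : ∀ k ∈ Finset.univ \ A, Rs k = 0 := fun k hk => if_neg (Finset.mem_sdiff.1 hk).2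
  refine ⟨Rs, Ro, fun k => ?_, fun k => ?_, hRs₀, fun S hS S' hS' T hT => ?_, ?_, ?_⟩
  · simp only [hRs]
    split_ifs
    · linarith [hvw k]
    · exact le_rfl
  · simp only [hRo]
    split_ifs
    exacts [hv k, hw k]
  · have hdisj : Disjoint S T := by
      rw [Finset.disjoint_left]
      exact fun k hk hkT => (Finset.mem_sdiff.1 (hT hkT)).2 (hS hk)
    have h₁ := hwf (S ∪ T)
    rw [Finset.sum_union hdisj] at h₁
    rw [hsRs S hS, hsRo _ (Finset.sdiff_subset.trans hS), hsRo' T hT]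
    linarith [Finset.sum_sdiff (f := v) hS', hgv S']
  · rw [← Finset.sum_sdiff (Finset.subset_univ A), Finset.sum_eq_zero hRs₀,
      hsRs A subset_rfl, hwA, hvA, zero_add]
  · have h := Finset.sum_sdiff (f := w) (Finset.subset_univ A)
    rw [← Finset.sum_sdiff (Finset.subset_univ A), hsRo A subset_rfl, hsRo' _ subset_rfl, hvA]
    linarith

theorem inter_union_univ_sdiff {ι : Type*} [Fintype ι] [DecidableEq ι] (S A : Finset ι) :
    S ∩ A ∪ Finset.univ \ A = S ∪ Finset.univ \ A := by
  ext
  simp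
  tauto

theorem univ_sdiff_sdiff {ι : Type*} [Fintype ι] [DecidableEq ι] (A S : Finset ι) :
    Finset.univ \ (A \ S) = S ∪ Finset.univ \ A := by
  ext
  simp
  tauto

theorem stmt8 {K : ℕ} (hK : 1 ≤ K) {Ω : Type} [Fintype Ω]
    {𝒳 : Fin K → Type} [∀ k, Fintype (𝒳 k)] {𝒴 𝒵 : Type} [Fintype 𝒴] [Fintype 𝒵]
    (p : Ω → ℝ) (hp : IsPMF p)
    (X : ∀ k, Ω → 𝒳 k) (Y : Ω → 𝒴) (Z : Ω → 𝒵) (hind : MutIndep p X)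
    (K'star : Finset (Fin K))
    (hatt : max 0 (IcondMut p (tup X K'star) Y (tup X (Finset.univ \ K'star)) -
                   IcondMut p (tup X K'star) Z (tup X (Finset.univ \ K'star))) =
      Finset.univ.sup' Finset.univ_nonempty (fun K' : Finset (Fin K) =>
        max 0 (IcondMut p (tup X K') Y (tup X (Finset.univ \ K')) -
               IcondMut p (tup X K') Z (tup X (Finset.univ \ K')))))
    (hpos : 0 < Finset.univ.sup' Finset.univ_nonempty (fun K' : Finset (Fin K) =>
        max 0 (IcondMut p (tup X K') Y (tup X (Finset.univ \ K')) -
               IcondMut p (tup X K') Z (tup X (Finset.univ \ K'))))) :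
    IsGreatest
      {r : ℝ | ∃ Rs Ro : Fin K → ℝ,
        InRegion p X Y Z K'star Rs Ro ∧
        (∑ k, Rs k) = Finset.univ.sup' Finset.univ_nonempty (fun K' : Finset (Fin K) =>
          max 0 (IcondMut p (tup X K') Y (tup X (Finset.univ \ K')) -
                 IcondMut p (tup X K') Z (tup X (Finset.univ \ K')))) ∧
        r = ∑ k, Ro k}
      (Imut p (tup X (Finset.univ \ K'star)) Y +
        IcondMut p (tup X K'star) Z (tup X (Finset.univ \ K'star))) := by
  set R : ℝ := Finset.univ.sup' Finset.univ_nonempty (fun K' : Finset (Fin K) =>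
    max 0 (IcondMut p (tup X K') Y (tup X (Finset.univ \ K')) -
      IcondMut p (tup X K') Z (tup X (Finset.univ \ K'))))
  set f : Finset (Fin K) → ℝ := fun U =>
    IcondMut p (tup X U) Y (tup X (Finset.univ \ U)) with hfdef
  set g : Finset (Fin K) → ℝ := fun S =>
    IcondMut p (tup X S) Z (tup X (Finset.univ \ K'star)) with hgdef
  have hf : ∀ U, f U = condHent p Y (tup X (Finset.univ \ U)) -
      condHent p Y (tup X Finset.univ) := fun U => by
    simp only [hfdef, IcondMut_tup_eq]
    rw [Finset.union_sdiff_of_subset (Finset.subset_univ U)]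
  have hg : ∀ S, g S = condHent p Z (tup X (Finset.univ \ K'star)) -
      condHent p Z (tup X (S ∪ (Finset.univ \ K'star))) := fun S => by
    simp only [hgdef, IcondMut_tup_eq]
  have hf₀ : f ∅ = 0 := by rw [hf, Finset.sdiff_empty, sub_self]
  have hg₀ : g ∅ = 0 := by rw [hg, Finset.empty_union, sub_self]
  have hfmono : Monotone f := fun S T hST => by
    rw [hf, hf]
    linarith [condHent_tup_anti hp X Y
      (Finset.sdiff_subset_sdiff (subset_refl Finset.univ) hST)]
  have hgmono : Monotone g := fun S T hST => by
    rw [hg, hg]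
    linarith [condHent_tup_anti hp X Z
      (Finset.union_subset_union_left (t := Finset.univ \ K'star) hST)]
  have hfsub : ∀ S T, f (S ∪ T) + f (S ∩ T) ≤ f S + f T := fun S T => by
    have h := condHent_tup_submodular hp X hind Y (Finset.univ \ S) (Finset.univ \ T)
    rw [← Finset.sdiff_inter_distrib_right, ← Finset.sdiff_union_distrib] at h
    simp only [hf]
    linarith
  have hgsup : ∀ S T, g S + g T ≤ g (S ∪ T) + g (S ∩ T) := fun S T => by
    have h := condHent_tup_submodular hp X hind Z (S ∪ (Finset.univ \ K'star))
      (T ∪ (Finset.univ \ K'star))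
    rw [← Finset.union_union_distrib_right, ← Finset.inter_union_distrib_right] at h
    simp only [hg]
    linarith
  have hgA : ∀ S, g (S ∩ K'star) = g S := fun S => by
    rw [hg, hg, inter_union_univ_sdiff]
  have hRA : f K'star - g K'star = R := by
    rcases max_choice 0 (f K'star - g K'star) with h | h
    · exact absurd (h.symm.trans hatt) hpos.ne
    · exact h.symm.trans hatt
  have hA : ∀ S ⊆ K'star, f (K'star \ S) + g S ≤ f K'star := fun S hS => by
    have h : f (K'star \ S) - IcondMut p (tup X (K'star \ S)) Z
        (tup X (Finset.univ \ (K'star \ S))) ≤ R :=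
      (le_max_right 0 _).trans (Finset.le_sup' (fun K' : Finset (Fin K) =>
        max 0 (IcondMut p (tup X K') Y (tup X (Finset.univ \ K')) -
          IcondMut p (tup X K') Z (tup X (Finset.univ \ K')))) (Finset.mem_univ (K'star \ S)))
    rw [IcondMut_tup_eq, Finset.union_sdiff_of_subset (Finset.subset_univ _),
      univ_sdiff_sdiff] at h
    have hgAA := hg K'star
    rw [Finset.union_sdiff_of_subset (Finset.subset_univ _)] at hgAA
    linarith [hg S]
  have hvalue : Imut p (tup X (Finset.univ \ K'star)) Y + g K'star =
      f Finset.univ - f K'star + g K'star := by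
    rw [Imut_tup_eq hp, hf, hf, Finset.sdiff_self]
    ring
  change IsGreatest _ (Imut p (tup X (Finset.univ \ K'star)) Y + g K'star)
  rw [hvalue]
  constructor
  · obtain ⟨Rs, Ro, hRs, hRo, hRs₀, hle, hsRs, hsRo⟩ :=
      exists_rates hf₀ hfmono hfsub hg₀ hgmono hgsup K'star hgA hA
    exact ⟨Rs, Ro, ⟨hRs, hRo, hRs₀, fun S hS S' hS' T hT =>
      (hle S hS S' hS' T hT).trans (le_max_right 0 _)⟩, hsRs.trans hRA, hsRo.symm⟩
  · rintro _ ⟨Rs, Ro, ⟨-, -, hRs₀, hle⟩, hsum, rfl⟩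
    have h : ∑ k ∈ K'star, Rs k + ∑ k ∈ K'star \ ∅, Ro k + ∑ k ∈ Finset.univ \ K'star, Ro k ≤
        max 0 (f (K'star ∪ (Finset.univ \ K'star)) - g ∅) :=
      hle K'star subset_rfl ∅ (Finset.empty_subset K'star) _ subset_rfl
    rw [Finset.union_sdiff_of_subset (Finset.subset_univ K'star), hg₀, sub_zero,
      Finset.sdiff_empty, max_eq_right (hf₀ ▸ hfmono (Finset.empty_subset _))] at h
    have hRsA := Finset.sum_sdiff (f := Rs) (Finset.subset_univ K'star)
    rw [Finset.sum_eq_zero hRs₀, zero_add] at hRsA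
    linarith [Finset.sum_sdiff (f := Ro) (Finset.subset_univ K'star)]
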